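/- arXiv:math/0508296 — 3 statements merged into one kernel-verified Lean document; each statement's English description precedes it below -/
import Mathlib

section
/- Let Ω be a Polish space and f : Ω → ℝ a bounded Borel measurable function. If λ is a finite nonnegative Borel measure on Ω that is carried by the set of points of continuity of f (i.e., λ assigns measure zero to the set of points of discontinuity of f), then the map μ ↦ ∫_Ω f dμ, defined on the space of finite nonnegative Borel measures on Ω equipped with the narrow topology, is continuous at the point λ. -/
open MeasureTheory

open Filter Topology

/-- The Pasch–Hausdorff envelope of `f`, i.e. its infimal convolution with `k * dist`. -/
noncomputable def lipschitzEnvelope {X : Type*} [PseudoMetricSpace X] (f : X → ℝ) (k : NNReal)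
    (x : X) : ℝ :=
  ⨅ y, (f y + k * dist x y)

section lipschitzEnvelope

variable {X : Type*} [PseudoMetricSpace X] {f : X → ℝ} {C : ℝ}

theorem bddBelow_range_add_mul_dist (hf : ∀ y, |f y| ≤ C) (k : NNReal) (x : X) :
    BddBelow (Set.range fun y => f y + k * dist x y) := by
  refine ⟨-C, ?_⟩
  rintro _ ⟨y, rfl⟩
  have h₁ := (abs_le.mp (hf y)).1
  have h₂ : 0 ≤ (k : ℝ) * dist x y := by positivity
  dsimp only
  linarith

theorem lipschitzEnvelope_le (hf : ∀ y, |f y| ≤ C) (k : NNReal) (x : X) :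
    lipschitzEnvelope f k x ≤ f x := by
  simpa using! ciInf_le (bddBelow_range_add_mul_dist hf k x) x

theorem neg_le_lipschitzEnvelope (hf : ∀ y, |f y| ≤ C) (k : NNReal) (x : X) :
    -C ≤ lipschitzEnvelope f k x := by
  have : Nonempty X := ⟨x⟩
  refine le_ciInf fun y => ?_
  have h₁ := (abs_le.mp (hf y)).1
  have h₂ : 0 ≤ (k : ℝ) * dist x y := by positivity
  linarith

theorem abs_lipschitzEnvelope_le (hf : ∀ y, |f y| ≤ C) (k : NNReal) (x : X) :
    |lipschitzEnvelope f k x| ≤ C :=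
  abs_le.mpr ⟨neg_le_lipschitzEnvelope hf k x,
    (lipschitzEnvelope_le hf k x).trans (abs_le.mp (hf x)).2⟩

theorem lipschitzWith_lipschitzEnvelope (hf : ∀ y, |f y| ≤ C) (k : NNReal) :
    LipschitzWith k (lipschitzEnvelope f k) := by
  refine LipschitzWith.of_le_add_mul k fun x z => ?_
  have : Nonempty X := ⟨x⟩
  rw [← sub_le_iff_le_add]
  refine le_ciInf fun y => ?_
  have h₁ : lipschitzEnvelope f k x ≤ f y + k * dist x y :=
    ciInf_le (bddBelow_range_add_mul_dist hf k x) y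
  have h₂ := mul_le_mul_of_nonneg_left (dist_triangle x z y) k.coe_nonneg
  linarith

theorem tendsto_lipschitzEnvelope (hf : ∀ y, |f y| ≤ C) {x : X} (hx : ContinuousAt f x) :
    Tendsto (fun n : ℕ => lipschitzEnvelope f n x) atTop (𝓝 (f x)) := by
  have : Nonempty X := ⟨x⟩
  refine tendsto_order.mpr ⟨fun a ha => ?_, fun a ha =>
    Eventually.of_forall fun n => (lipschitzEnvelope_le hf n x).trans_lt ha⟩
  obtain ⟨b, hab, hb⟩ := exists_between ha
  obtain ⟨δ, hδ, hball⟩ := Metric.eventually_nhds_iff.mp (hx.eventually_const_lt hb)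
  filter_upwards [tendsto_natCast_atTop_atTop.eventually_ge_atTop (2 * C / δ)] with n hn
  refine hab.trans_le (le_ciInf fun y => ?_)
  rw [NNReal.coe_natCast]
  rcases lt_or_ge (dist x y) δ with hy | hy
  · have h₁ := hball (dist_comm x y ▸ hy)
    have h₂ : 0 ≤ (n : ℝ) * dist x y := by positivity
    linarith
  · have h₁ := (div_le_iff₀ hδ).mp hn
    have h₂ := mul_le_mul_of_nonneg_left hy n.cast_nonneg
    have h₃ := (abs_le.mp (hf y)).1
    have h₄ := (abs_le.mp (hf x)).2
    linarith

end lipschitzEnvelope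

theorem eventually_lt_integral_of_ae_continuousAt
    {X : Type*} [TopologicalSpace X] [TopologicalSpace.PseudoMetrizableSpace X]
    [MeasurableSpace X] [OpensMeasurableSpace X] {f : X → ℝ} (hf : Measurable f) {C : ℝ}
    (hC : ∀ x, |f x| ≤ C) {lam : FiniteMeasure X}
    (hcont : ∀ᵐ x ∂(lam : Measure X), ContinuousAt f x) {a : ℝ}
    (ha : a < ∫ x, f x ∂(lam : Measure X)) :
    ∀ᶠ μ : FiniteMeasure X in 𝓝 lam, a < ∫ x, f x ∂(μ : Measure X) := by
  let : PseudoMetricSpace X := TopologicalSpace.pseudoMetrizableSpacePseudoMetric X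
  have hlip (n : ℕ) : Continuous (lipschitzEnvelope f n) :=
    (lipschitzWith_lipschitzEnvelope hC n).continuous
  have hlim : Tendsto (fun n : ℕ => ∫ x, lipschitzEnvelope f n x ∂(lam : Measure X)) atTop
      (𝓝 (∫ x, f x ∂(lam : Measure X))) :=
    tendsto_integral_of_dominated_convergence (fun _ => C)
      (fun n => (hlip n).measurable.aestronglyMeasurable) (integrable_const C)
      (fun n => Eventually.of_forall (abs_lipschitzEnvelope_le hC n))
      (hcont.mono fun x hx => tendsto_lipschitzEnvelope hC hx)
  obtain ⟨n, hn⟩ := (hlim.eventually_const_lt ha).exists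
  let g : BoundedContinuousFunction X ℝ :=
    .ofNormedAddCommGroup (lipschitzEnvelope f n) (hlip n) C (abs_lipschitzEnvelope_le hC n)
  have hg : Tendsto (fun μ : FiniteMeasure X => ∫ x, g x ∂(μ : Measure X)) (𝓝 lam)
      (𝓝 (∫ x, g x ∂(lam : Measure X))) :=
    FiniteMeasure.tendsto_iff_forall_integral_tendsto.mp tendsto_id g
  filter_upwards [hg.eventually_const_lt hn] with μ hμ
  exact hμ.trans_le (integral_mono (g.integrable _)
    (Integrable.of_bound hf.aestronglyMeasurable C (Eventually.of_forall hC))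
    (lipschitzEnvelope_le hC n))

/-- **Lemma (Dellacherie–Meyer III.57).** Let `Ω` be a Polish space and `f : Ω → ℝ` a bounded
Borel measurable function. If a finite nonnegative Borel measure `lam` is carried by the set of
points of continuity of `f` (i.e., the set of points of discontinuity of `f` is `lam`-null),
then the map `μ ↦ ∫ f dμ` on the space of finite measures with the narrow topology is
continuous at `lam`. -/
theorem integral_continuousAt_of_carried_by_continuity_points
    {Ω : Type*} [TopologicalSpace Ω] [PolishSpace Ω] [MeasurableSpace Ω] [BorelSpace Ω]
    (f : Ω → ℝ) (hf : Measurable f) (hbdd : ∃ C : ℝ, ∀ x, |f x| ≤ C)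
    (lam : FiniteMeasure Ω)
    (hcarried : (lam : Measure Ω) {x | ¬ ContinuousAt f x} = 0) :
    ContinuousAt (fun μ : FiniteMeasure Ω => ∫ x, f x ∂(μ : Measure Ω)) lam := by
  obtain ⟨C, hC⟩ := hbdd
  have hcont : ∀ᵐ x ∂(lam : Measure Ω), ContinuousAt f x := hcarried
  refine tendsto_order.mpr ⟨fun a ha => eventually_lt_integral_of_ae_continuousAt hf hC hcont ha,
    fun a ha => ?_⟩
  have hneg := eventually_lt_integral_of_ae_continuousAt (f := fun x => -f x) (a := -a) hf.neg
    (by simpa only [abs_neg] using hC) (hcont.mono fun x hx => hx.neg)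
    (by rw [integral_neg]; exact neg_lt_neg ha)
  filter_upwards [hneg] with μ hμ
  rw [integral_neg] at hμ
  exact neg_lt_neg_iff.mp hμ
end

section
/- Let Ω be a Polish space, let M be a subset of the space of finite nonnegative Borel measures on Ω that is closed in the narrow topology and bounded in norm (i.e., there exists C such that μ(Ω) ≤ C for all μ ∈ M), with M carrying the subspace narrow topology. Then the mixing operator Mix, sending a finite nonnegative Borel measure ν on M to the finite nonnegative Borel measure Mix(ν) on Ω defined by Mix(ν)(A) = ∫_M μ(A) ν(dμ) for every Borel A ⊆ Ω, is continuous from the space of finite nonnegative Borel measures on M with the narrow topology to the space of finite nonnegative Borel measures on Ω with the narrow topology. -/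
open MeasureTheory
open scoped ENNReal NNReal

/-- A narrowly continuous family of finite measures is measurable for the Giry σ-algebra. -/
theorem measurable_toMeasure_of_continuous
    {X Ω : Type*} [TopologicalSpace X] [MeasurableSpace X] [OpensMeasurableSpace X]
    [TopologicalSpace Ω] [HasOuterApproxClosed Ω] [MeasurableSpace Ω] [BorelSpace Ω]
    {κ : X → FiniteMeasure Ω} (hκ : Continuous κ) :
    Measurable fun x ↦ (κ x : Measure Ω) := by
  have hclosed (F : Set Ω) (hF : IsClosed F) : Measurable fun x ↦ (κ x : Measure Ω) F :=
    measurable_of_tendsto_metrizable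
      (fun n ↦ (ENNReal.continuous_coe.comp
        ((FiniteMeasure.continuous_testAgainstNN_eval (hF.apprSeq n)).comp hκ)).measurable)
      (tendsto_pi_nhds.2 fun x ↦ by
        simpa using HasOuterApproxClosed.tendsto_lintegral_apprSeq hF (κ x : Measure Ω))
  exact Measurable.measure_of_isPiSystem
    (BorelSpace.measurable_eq.trans borel_eq_generateFrom_isClosed) isPiSystem_isClosed
    hclosed (hclosed _ isClosed_univ)

open scoped BoundedContinuousFunction in
/-- Mixing a bounded, narrowly continuous family of finite measures is narrowly continuous in the
mixing measure. -/
theorem exists_continuous_mixing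
    {X Ω : Type*} [TopologicalSpace X] [MeasurableSpace X] [OpensMeasurableSpace X]
    [TopologicalSpace Ω] [HasOuterApproxClosed Ω] [MeasurableSpace Ω] [BorelSpace Ω]
    {κ : X → FiniteMeasure Ω} (hκ : Continuous κ)
    {C : ℝ≥0} (hC : ∀ x, (κ x : Measure Ω) Set.univ ≤ C) :
    ∃ Mix : FiniteMeasure X → FiniteMeasure Ω, Continuous Mix ∧
      ∀ (ν : FiniteMeasure X) (A : Set Ω), MeasurableSet A →
        (Mix ν : Measure Ω) A = ∫⁻ x, (κ x : Measure Ω) A ∂(ν : Measure X) := by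
  have hmeas := measurable_toMeasure_of_continuous hκ
  have hfin (ν : FiniteMeasure X) :
      IsFiniteMeasure ((ν : Measure X).bind fun x ↦ (κ x : Measure Ω)) := by
    refine ⟨?_⟩
    rw [Measure.bind_apply .univ hmeas.aemeasurable]
    calc ∫⁻ x, (κ x : Measure Ω) Set.univ ∂(ν : Measure X)
        ≤ ∫⁻ _, (C : ℝ≥0∞) ∂(ν : Measure X) := lintegral_mono hC
      _ < ∞ := by
        rw [lintegral_const]
        exact ENNReal.mul_lt_top ENNReal.coe_lt_top (measure_lt_top _ _)
  let Mix (ν : FiniteMeasure X) : FiniteMeasure Ω := ⟨_, hfin ν⟩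
  refine ⟨Mix, FiniteMeasure.continuous_iff_forall_continuous_lintegral.2 ?_,
    fun ν A hA ↦ Measure.bind_apply hA hmeas.aemeasurable⟩
  intro f
  have hcont : Continuous fun x ↦ (κ x).testAgainstNN f :=
    (FiniteMeasure.continuous_testAgainstNN_eval f).comp hκ
  have hbound (x : X) : (κ x).testAgainstNN f ≤ nndist f 0 * C := by
    have hmass : (κ x).mass ≤ C := by
      rw [← ENNReal.coe_le_coe, FiniteMeasure.ennreal_mass]
      exact hC x
    have h := FiniteMeasure.testAgainstNN_lipschitz_estimate (κ x) f 0
    rw [FiniteMeasure.testAgainstNN_zero, zero_add] at h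
    exact h.trans (by gcongr)
  let g : X →ᵇ ℝ≥0 := .mkOfBound ⟨_, hcont⟩ (nndist f 0 * C) fun x y ↦ by
    have hx : ((κ x).testAgainstNN f : ℝ) ≤ nndist f 0 * C := mod_cast hbound x
    have hy : ((κ y).testAgainstNN f : ℝ) ≤ nndist f 0 * C := mod_cast hbound y
    exact abs_sub_le_of_nonneg_of_le NNReal.zero_le_coe hx NNReal.zero_le_coe hy
  have hg (ν : FiniteMeasure X) :
      ∫⁻ ω, f ω ∂(Mix ν : Measure Ω) = ∫⁻ x, g x ∂(ν : Measure X) := by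
    refine (Measure.lintegral_bind hmeas.aemeasurable
      f.measurable_coe_ennreal_comp.aemeasurable).trans ?_
    exact lintegral_congr fun x ↦ FiniteMeasure.testAgainstNN_coe_eq.symm
  simp only [hg]
  exact FiniteMeasure.continuous_lintegral_boundedContinuousFunction g

/-- **Theorem (continuity of the mixing operator).** Let `Ω` be a Polish space and let `M` be a
narrowly closed, norm-bounded set of finite nonnegative Borel measures on `Ω` (with the
subspace narrow topology and its Borel σ-algebra). Then the mixing operator
`Mix : FiniteMeasure M → FiniteMeasure Ω`, characterized by
`Mix(ν)(A) = ∫ μ(A) ν(dμ)` for every Borel `A ⊆ Ω`, is continuous with respect to the narrow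
topologies. -/
theorem mixing_operator_continuous
    {Ω : Type*} [TopologicalSpace Ω] [PolishSpace Ω] [MeasurableSpace Ω] [BorelSpace Ω]
    (M : Set (FiniteMeasure Ω)) (hMclosed : IsClosed M)
    (C : ℝ≥0) (hMbdd : ∀ μ ∈ M, (μ : Measure Ω) Set.univ ≤ (C : ℝ≥0∞)) :
    letI : MeasurableSpace M := borel M
    haveI : BorelSpace M := ⟨rfl⟩
    ∃ Mix : FiniteMeasure M → FiniteMeasure Ω,
      Continuous Mix ∧
        ∀ (ν : FiniteMeasure M) (A : Set Ω), MeasurableSet A →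
          (Mix ν : Measure Ω) A
            = ∫⁻ μ : M, ((μ : FiniteMeasure Ω) : Measure Ω) A ∂(ν : Measure M) := by
  let : MeasurableSpace M := borel M
  have : BorelSpace M := ⟨rfl⟩
  exact exists_continuous_mixing continuous_subtype_val fun μ ↦ hMbdd μ μ.2
end

section
/- Let Ω be a Polish space, M a norm-bounded, narrowly closed set of finite nonnegative Borel measures on Ω (with the subspace narrow topology), and let {ν_k} be a sequence of finite nonnegative Borel measures on M converging narrowly to ν₀. Then for every Borel set A ⊆ Ω with Mix(ν₀)(∂A) = 0, one has Mix(ν_k)(A) → Mix(ν₀)(A), where Mix(ν)(A) = ∫_M μ(A) ν(dμ) and ∂A is the topological boundary of A. -/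
open MeasureTheory Filter
open scoped ENNReal NNReal Topology

namespace MeasureTheory.FiniteMeasure

/-- The portmanteau theorem for finite measures: masses of sets whose frontier is null for the
limit measure converge. -/
theorem tendsto_apply_of_null_frontier {Ω ι : Type*} {L : Filter ι} [MeasurableSpace Ω]
    [TopologicalSpace Ω] [OpensMeasurableSpace Ω] [HasOuterApproxClosed Ω]
    {μ : FiniteMeasure Ω} {μs : ι → FiniteMeasure Ω} (μs_lim : Tendsto μs L (𝓝 μ))
    {E : Set Ω} (E_nullbdry : μ (frontier E) = 0) :
    Tendsto (fun i ↦ μs i E) L (𝓝 (μ E)) := by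
  by_cases hμ : μ = 0
  · subst hμ
    have hmass := μs_lim.mass
    rw [zero_mass] at hmass
    exact tendsto_of_tendsto_of_tendsto_of_le_of_le tendsto_const_nhds hmass
      (fun _ ↦ zero_le) (fun i ↦ (μs i).apply_le_mass E)
  · have : Nonempty Ω := by
      by_contra h
      rw [not_nonempty_iff] at h
      exact hμ (eq_of_forall_apply_eq _ _ fun s _ ↦ by simp [Set.eq_empty_of_isEmpty s])
    have hfr : μ.normalize (frontier E) = 0 := by
      rw [μ.normalize_eq_of_nonzero hμ, E_nullbdry, mul_zero]
    have hlim := ProbabilityMeasure.tendsto_measure_of_null_frontier_of_tendsto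
      (tendsto_normalize_of_tendsto μs_lim hμ) hfr
    simp_rw [self_eq_mass_mul_normalize _ E]
    exact μs_lim.mass.mul hlim

/-- The mixture of a uniformly bounded measurable family against a finite measure is finite. -/
theorem isFiniteMeasure_bind {X Ω : Type*} [MeasurableSpace X] [MeasurableSpace Ω]
    {κ : X → FiniteMeasure Ω} (hκ : Measurable fun x ↦ (κ x : Measure Ω))
    {C : ℝ≥0} (hC : ∀ x, (κ x).mass ≤ C) (ρ : Measure X) [IsFiniteMeasure ρ] :
    IsFiniteMeasure (ρ.bind fun x ↦ (κ x : Measure Ω)) := by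
  refine ⟨?_⟩
  rw [Measure.bind_apply .univ hκ.aemeasurable]
  calc ∫⁻ x, (κ x : Measure Ω) Set.univ ∂ρ ≤ ∫⁻ _, (C : ℝ≥0∞) ∂ρ :=
        lintegral_mono fun x ↦ by
          rw [← ennreal_mass]
          exact ENNReal.coe_le_coe.mpr (hC x)
    _ < ∞ := by
        rw [lintegral_const]
        exact ENNReal.mul_lt_top ENNReal.coe_lt_top (measure_lt_top ρ _)

section Mixture

variable {X Ω : Type*} [TopologicalSpace X] [MeasurableSpace X] [OpensMeasurableSpace X]
  [TopologicalSpace Ω] [MeasurableSpace Ω] [BorelSpace Ω] {κ : X → FiniteMeasure Ω}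

/-- A narrowly continuous family of finite measures is measurable. -/
theorem measurable_toMeasure_of_continuous [HasOuterApproxClosed Ω] (hκ : Continuous κ) :
    Measurable fun x ↦ (κ x : Measure Ω) := by
  have hlint (f : BoundedContinuousFunction Ω ℝ≥0) :
      Measurable fun x ↦ ∫⁻ ω, f ω ∂(κ x : Measure Ω) :=
    (continuous_iff_forall_continuous_lintegral.mp hκ f).measurable
  have hclosed (F : Set Ω) (hF : IsClosed F) : Measurable fun x ↦ (κ x : Measure Ω) F :=
    measurable_of_tendsto_metrizable (fun n ↦ hlint (hF.apprSeq n))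
      (tendsto_pi_nhds.mpr fun x ↦
        HasOuterApproxClosed.tendsto_lintegral_apprSeq hF (κ x : Measure Ω))
  exact Measurable.measure_of_isPiSystem
    (BorelSpace.measurable_eq.trans borel_eq_generateFrom_isClosed) isPiSystem_isClosed hclosed (hclosed _ isClosed_univ)

/-- Narrow convergence is preserved by mixing a uniformly bounded narrowly continuous family. -/
theorem tendsto_bind_of_continuous [HasOuterApproxClosed Ω] (hκ : Continuous κ)
    {C : ℝ≥0} (hC : ∀ x, (κ x).mass ≤ C) {ι : Type*} {L : Filter ι}
    {ν : ι → FiniteMeasure X} {ν₀ : FiniteMeasure X} (hν : Tendsto ν L (𝓝 ν₀))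
    {ξ : ι → FiniteMeasure Ω} {ξ₀ : FiniteMeasure Ω}
    (hξ : ∀ i, (ξ i : Measure Ω) = (ν i : Measure X).bind fun x ↦ (κ x : Measure Ω))
    (hξ₀ : (ξ₀ : Measure Ω) = (ν₀ : Measure X).bind fun x ↦ (κ x : Measure Ω)) :
    Tendsto ξ L (𝓝 ξ₀) := by
  rw [tendsto_iff_forall_lintegral_tendsto]
  intro f
  have hf : Measurable fun ω ↦ (f ω : ℝ≥0∞) := f.continuous.measurable.coe_nnreal_ennreal
  have hκm := measurable_toMeasure_of_continuous hκ
  have hbdd (x : X) : (κ x).testAgainstNN f ≤ nndist f 0 * C := by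
    simpa using ((κ x).testAgainstNN_lipschitz_estimate f 0).trans
      (add_le_add_right (mul_le_mul_right (hC x) (nndist f 0)) _)
  let g : BoundedContinuousFunction X ℝ≥0 := BoundedContinuousFunction.mkOfBound
    ⟨fun x ↦ (κ x).testAgainstNN f, (continuous_testAgainstNN_eval f).comp hκ⟩
    (nndist f 0 * C : ℝ≥0) fun x y ↦ by
      refine (NNReal.dist_eq _ _).trans_le (abs_sub_le_of_nonneg_of_le ?_ ?_ ?_ ?_)
      exacts [NNReal.coe_nonneg _, NNReal.coe_le_coe.mpr (hbdd x), NNReal.coe_nonneg _,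
        NNReal.coe_le_coe.mpr (hbdd y)]
  have hg (ρ : Measure X) : ∫⁻ ω, f ω ∂(ρ.bind fun x ↦ (κ x : Measure Ω)) = ∫⁻ x, g x ∂ρ := by
    rw [Measure.lintegral_bind hκm.aemeasurable hf.aemeasurable]
    exact lintegral_congr fun x ↦ testAgainstNN_coe_eq.symm
  simp_rw [hξ, hξ₀, hg]
  exact tendsto_iff_forall_lintegral_tendsto.mp hν g

end Mixture

/-- Portmanteau theorem for mixtures of a uniformly bounded narrowly continuous family. -/
theorem tendsto_lintegral_apply_of_null_frontier {X Ω : Type*} [TopologicalSpace X]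
    [MeasurableSpace X] [OpensMeasurableSpace X] [TopologicalSpace Ω] [MeasurableSpace Ω]
    [BorelSpace Ω] [HasOuterApproxClosed Ω] {κ : X → FiniteMeasure Ω} (hκ : Continuous κ)
    {C : ℝ≥0} (hC : ∀ x, (κ x).mass ≤ C) {ι : Type*} {L : Filter ι}
    {ν : ι → FiniteMeasure X} {ν₀ : FiniteMeasure X} (hν : Tendsto ν L (𝓝 ν₀))
    {A : Set Ω} (hA : MeasurableSet A)
    (hfr : ∫⁻ x, (κ x : Measure Ω) (frontier A) ∂(ν₀ : Measure X) = 0) :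
    Tendsto (fun i ↦ ∫⁻ x, (κ x : Measure Ω) A ∂(ν i : Measure X)) L
      (𝓝 (∫⁻ x, (κ x : Measure Ω) A ∂(ν₀ : Measure X))) := by
  have hκm := measurable_toMeasure_of_continuous hκ
  let mix (ρ : FiniteMeasure X) : FiniteMeasure Ω :=
    ⟨(ρ : Measure X).bind fun x ↦ (κ x : Measure Ω), isFiniteMeasure_bind hκm hC _⟩
  have hmix (ρ : FiniteMeasure X) {B : Set Ω} (hB : MeasurableSet B) :
      ((mix ρ B : ℝ≥0) : ℝ≥0∞) = ∫⁻ x, (κ x : Measure Ω) B ∂(ρ : Measure X) := by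
    rw [ennreal_coeFn_eq_coeFn_toMeasure]
    exact Measure.bind_apply hB hκm.aemeasurable
  have hlim : Tendsto (fun i ↦ mix (ν i)) L (𝓝 (mix ν₀)) :=
    tendsto_bind_of_continuous hκ hC hν (fun _ ↦ rfl) rfl
  have hfr' : mix ν₀ (frontier A) = 0 := by
    rw [← ENNReal.coe_eq_zero, hmix ν₀ isClosed_frontier.measurableSet, hfr]
  simp_rw [← hmix _ hA]
  exact ENNReal.tendsto_coe.mpr (tendsto_apply_of_null_frontier hlim hfr')

end MeasureTheory.FiniteMeasure

/-- Let `Ω` be a Polish space, `M` a norm-bounded, narrowly closed set of finite nonnegative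
Borel measures on `Ω`, and `ν_k → ν₀` a narrowly convergent sequence of finite measures on `M`.
Then for every Borel `A ⊆ Ω` with `Mix(ν₀)(∂A) = 0` one has
`Mix(ν_k)(A) → Mix(ν₀)(A)`, where `Mix(ν)(A) = ∫ μ(A) ν(dμ)`. -/
theorem mix_tendsto_of_frontier_null
    {Ω : Type*} [TopologicalSpace Ω] [PolishSpace Ω] [MeasurableSpace Ω] [BorelSpace Ω]
    (M : Set (FiniteMeasure Ω)) (hMclosed : IsClosed M)
    (C : ℝ≥0) (hMbdd : ∀ μ ∈ M, (μ : Measure Ω) Set.univ ≤ (C : ℝ≥0∞)) :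
    letI : MeasurableSpace M := borel M
    haveI : BorelSpace M := ⟨rfl⟩
    ∀ (ν : ℕ → FiniteMeasure M) (ν₀ : FiniteMeasure M),
      Tendsto ν atTop (𝓝 ν₀) →
      ∀ A : Set Ω, MeasurableSet A →
        ∫⁻ μ : M, ((μ : FiniteMeasure Ω) : Measure Ω) (frontier A) ∂(ν₀ : Measure M) = 0 →
        Tendsto
          (fun k => ∫⁻ μ : M, ((μ : FiniteMeasure Ω) : Measure Ω) A ∂(ν k : Measure M))
          atTop
          (𝓝 (∫⁻ μ : M, ((μ : FiniteMeasure Ω) : Measure Ω) A ∂(ν₀ : Measure M))) := by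
  let : MeasurableSpace M := borel M
  have : BorelSpace M := ⟨rfl⟩
  let := TopologicalSpace.upgradeIsCompletelyMetrizable Ω
  intro ν ν₀ hν A hA hfr
  refine FiniteMeasure.tendsto_lintegral_apply_of_null_frontier continuous_subtype_val
    (C := C) (fun μ ↦ ?_) hν hA hfr
  rw [← ENNReal.coe_le_coe, FiniteMeasure.ennreal_mass]
  exact hMbdd μ μ.2
end
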